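/- arXiv:1012.1350 — 2 statements merged into one kernel-verified Lean document; each statement's English description precedes it below -/
import Mathlib

section
/- For every k ≥ 16 there exist k distinct points lying on a circle in EuclideanSpace ℝ (Fin 2) such that the set of these k points is not subtransitive. In particular, there exists a cyclic 16-gon that is spherical but not subtransitive. -/
/-- A finite set `X ⊆ ℝ^n` is transitive if its symmetry group acts transitively on it. -/
def IsTransitiveSet {n : ℕ} (X : Set (EuclideanSpace ℝ (Fin n))) : Prop :=
  ∀ x ∈ X, ∀ y ∈ X,
    ∃ g : EuclideanSpace ℝ (Fin n) ≃ᵢ EuclideanSpace ℝ (Fin n), g '' X = X ∧ g x = y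

/-- A set `X ⊆ ℝ^{n'}` is subtransitive if some isometric copy of `X` is contained in a
finite transitive set (in a possibly higher-dimensional Euclidean space). -/
def IsSubtransitive {n' : ℕ} (X : Set (EuclideanSpace ℝ (Fin n'))) : Prop :=
  ∃ (n : ℕ) (f : EuclideanSpace ℝ (Fin n') → EuclideanSpace ℝ (Fin n))
    (T : Set (EuclideanSpace ℝ (Fin n))),
    T.Finite ∧ IsTransitiveSet T ∧
    (∀ x ∈ X, ∀ y ∈ X, dist (f x) (f y) = dist x y) ∧ f '' X ⊆ T

open Polynomial in
/-- If the coefficients `p i` are simultaneously positive at some rational point, then at a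
transcendental point `u` the weighted difference operator `φ ↦ ∑ i, p i (u) (φ σ - φ (σ * h i))` on
a finite group generated by the `h i` annihilates only constant functions. -/
theorem eq_of_sum_aeval_mul_sub_eq_zero {G ι : Type*} [Group G] [Finite G] [Fintype ι]
    (h : ι → G) (hgen : Subgroup.closure (Set.range h) = ⊤) (p : ι → ℚ[X]) (q : ℚ)
    (hq : ∀ i, 0 < (p i).eval q) {u : ℝ} (hu : Transcendental ℚ u) (φ : G → ℝ)
    (hφ : ∀ σ, ∑ i, aeval u (p i) * (φ σ - φ (σ * h i)) = 0) (g : G) : φ g = φ 1 := by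
  classical
  cases nonempty_fintype G
  let N : Matrix G G ℚ[X] := Matrix.of fun σ τ =>
    ∑ i, p i * ((if σ = τ then 1 else 0) - (if σ * h i = τ then 1 else 0)) +
      if 1 = τ then 1 else 0
  have mulVec_map : ∀ {R : Type} [CommRing R] (f : ℚ[X] →+* R) (ψ : G → R) (σ : G),
      (f.mapMatrix N).mulVec ψ σ = ∑ i, f (p i) * (ψ σ - ψ (σ * h i)) + ψ 1 := by
    intro R _ f ψ σ
    have key : ∀ τ, f (N σ τ) * ψ τ =
        ∑ i, f (p i) * ((if σ = τ then ψ τ else 0) - (if σ * h i = τ then ψ τ else 0)) +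
          if 1 = τ then ψ τ else 0 := by
      intro τ
      simp only [N, Matrix.of_apply, map_add, map_sum, map_mul, map_sub, add_mul,
        Finset.sum_mul, apply_ite f, map_one, map_zero, ite_mul, one_mul, zero_mul, mul_assoc,
        sub_mul]
    simp only [Matrix.mulVec, dotProduct, RingHom.mapMatrix_apply, Matrix.map_apply, key,
      Finset.sum_add_distrib]
    rw [Finset.sum_comm]
    simp [← Finset.mul_sum]
  by_contra hne
  have hdet_u : aeval u N.det = 0 := by
    have : ((aeval u : ℚ[X] →ₐ[ℚ] ℝ).toRingHom.mapMatrix N).det = 0 := by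
      refine Matrix.exists_mulVec_eq_zero_iff.1 ⟨fun σ => φ σ - φ 1, ?_, ?_⟩
      · exact fun h0 => hne (sub_eq_zero.1 (congrFun h0 g))
      · ext σ
        rw [mulVec_map]
        simpa using hφ σ
    rwa [← RingHom.map_det] at this
  have hdet : N.det = 0 := by
    by_contra h0
    exact hu ⟨N.det, h0, hdet_u⟩
  have hdet_q : ((evalRingHom q).mapMatrix N).det = 0 := by
    rw [← RingHom.map_det, hdet, map_zero]
  obtain ⟨ψ, hψ0, hψ⟩ := Matrix.exists_mulVec_eq_zero_iff.2 hdet_q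
  replace hψ : ∀ σ, ∑ i, (p i).eval q * (ψ σ - ψ (σ * h i)) + ψ 1 = 0 := fun σ => by
    have := congrFun hψ σ
    rwa [mulVec_map] at this
  have hshift : ∀ (F : G → ℚ) (i : ι), ∑ σ, F (σ * h i) = ∑ σ, F σ := fun F i =>
    Equiv.sum_comp (Equiv.mulRight (h i)) F
  have hψ1 : ψ 1 = 0 := by
    have hsum : ∑ σ, (∑ i, (p i).eval q * (ψ σ - ψ (σ * h i)) + ψ 1) = 0 :=
      Finset.sum_eq_zero fun σ _ => hψ σ
    rw [Finset.sum_add_distrib, Finset.sum_comm] at hsum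
    simp only [← Finset.mul_sum, Finset.sum_sub_distrib, hshift ψ] at hsum
    simpa using hsum
  have henergy : ∑ i, (p i).eval q * ∑ σ, (ψ σ - ψ (σ * h i)) ^ 2 = 0 := by
    have hsum : ∑ σ, 2 * ψ σ * ∑ i, (p i).eval q * (ψ σ - ψ (σ * h i)) = 0 :=
      Finset.sum_eq_zero fun σ _ => by
        have := hψ σ
        rw [hψ1, add_zero] at this
        rw [this, mul_zero]
    rw [← hsum]
    simp only [Finset.mul_sum]
    rw [Finset.sum_comm (s := (Finset.univ : Finset G))]
    refine Finset.sum_congr rfl fun i _ => ?_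
    have h2 := hshift (fun σ => ψ σ ^ 2) i
    rw [← sub_eq_zero, ← Finset.sum_sub_distrib] at h2 ⊢
    have : ∑ σ, (p i).eval q * (ψ (σ * h i) ^ 2 - ψ σ ^ 2) = 0 := by
      rw [← Finset.mul_sum, h2, mul_zero]
    rw [← this]
    exact Finset.sum_congr rfl fun σ _ => by ring
  have hinv : ∀ i σ, ψ (σ * h i) = ψ σ := by
    intro i σ
    have h1 := (Finset.sum_eq_zero_iff_of_nonneg fun i _ =>
      mul_nonneg (hq i).le (Finset.sum_nonneg fun σ _ => sq_nonneg _)).1 henergy i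
        (Finset.mem_univ i)
    have h2 := (Finset.sum_eq_zero_iff_of_nonneg fun σ _ => sq_nonneg _).1
      ((mul_eq_zero.1 h1).resolve_left (hq i).ne') σ (Finset.mem_univ σ)
    exact (sub_eq_zero.1 (pow_eq_zero_iff two_ne_zero |>.1 h2)).symm
  have hall : ∀ g : G, ∀ σ, ψ (σ * g) = ψ σ := by
    intro g
    have hg : g ∈ Subgroup.closure (Set.range h) := hgen ▸ Subgroup.mem_top g
    induction hg using Subgroup.closure_induction with
    | mem x hx => obtain ⟨i, rfl⟩ := hx; exact hinv i
    | one => simp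
    | mul x y _ _ hx hy => intro σ; rw [← mul_assoc, hy, hx]
    | inv x _ hx => intro σ; rw [← hx (σ * x⁻¹), inv_mul_cancel_right]
  exact hψ0 (funext fun σ => by simpa [hψ1] using hall σ 1)

/-- Linear relations between the difference vectors `v - y i` depend only on the mutual distances
of the points. -/
theorem sum_smul_sub_eq_zero_of_dist_eq {E F ι : Type*} [Fintype ι]
    [NormedAddCommGroup E] [InnerProductSpace ℝ E] [NormedAddCommGroup F] [InnerProductSpace ℝ F]
    {v : E} {y : ι → E} {v' : F} {y' : ι → F} (hv : ∀ i, dist v' (y' i) = dist v (y i))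
    (hy : ∀ i j, dist (y' i) (y' j) = dist (y i) (y j)) {c : ι → ℝ}
    (hc : ∑ i, c i • (v - y i) = 0) : ∑ i, c i • (v' - y' i) = 0 := by
  have hinner : ∀ i j, inner ℝ (v' - y' i) (v' - y' j) = inner ℝ (v - y i) (v - y j) := by
    intro i j
    simp only [real_inner_eq_norm_mul_self_add_norm_mul_self_sub_norm_sub_mul_self_div_two,
      sub_sub_sub_cancel_left, ← dist_eq_norm, hv, hy]
  rw [← inner_self_eq_zero (𝕜 := ℝ)] at hc ⊢
  rw [← hc]
  simp only [sum_inner, inner_sum, inner_smul_left, inner_smul_right, hinner]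

/-- The restriction to `T` of an isometry of the ambient space mapping `T` onto itself. -/
def IsometryEquiv.restrictOfImageEq {E : Type*} [PseudoEMetricSpace E] {T : Set E} (g : E ≃ᵢ E)
    (hg : g '' T = T) : T ≃ᵢ T where
  toEquiv := g.toEquiv.subtypeEquiv fun a =>
    ⟨fun ha => hg ▸ Set.mem_image_of_mem g ha, fun ha => by
      rw [← hg] at ha
      exact (g.injective.mem_set_image).1 ha⟩
  isometry_toFun := fun a b => g.isometry a b

open Polynomial in
/-- In a finite transitive set, an affine relation `∑ i, p i (u) • (v - y i) = 0` at a
transcendental `u` is trivial if the polynomials `p i` are simultaneously positive at some rational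
point. -/
theorem IsTransitiveSet.eq_of_sum_aeval_smul_sub_eq_zero {n : ℕ} {ι : Type*} [Fintype ι]
    {T : Set (EuclideanSpace ℝ (Fin n))} (hT : IsTransitiveSet T) (hfin : T.Finite)
    {v : EuclideanSpace ℝ (Fin n)} (hv : v ∈ T) {y : ι → EuclideanSpace ℝ (Fin n)}
    (hy : ∀ i, y i ∈ T) (p : ι → ℚ[X]) (q : ℚ) (hq : ∀ i, 0 < (p i).eval q) {u : ℝ}
    (hu : Transcendental ℚ u) (hrel : ∑ i, aeval u (p i) • (v - y i) = 0) (i : ι) :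
    y i = v := by
  have : Finite T := hfin
  have : Finite (T ≃ᵢ T) :=
    Finite.of_injective IsometryEquiv.toEquiv IsometryEquiv.toEquiv_injective
  let v₀ : T := ⟨v, hv⟩
  have hex : ∀ i, ∃ h : T ≃ᵢ T, (h v₀ : EuclideanSpace ℝ (Fin n)) = y i := fun i => by
    obtain ⟨g, hgT, hg⟩ := hT v hv (y i) (hy i)
    exact ⟨g.restrictOfImageEq hgT, hg⟩
  choose h hh using hex
  let H := Subgroup.closure (Set.range h)
  let h' : ι → H := fun i => ⟨h i, Subgroup.subset_closure ⟨i, rfl⟩⟩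
  have hgen : Subgroup.closure (Set.range h') = ⊤ := by
    rw [← Subgroup.closure_closure_coe_preimage (k := Set.range h)]
    congr 1
    ext ⟨x, hx⟩
    simp [h', Subtype.ext_iff]
  have horbit : ∀ σ : T ≃ᵢ T, ∑ i, aeval u (p i) •
      ((σ v₀ : EuclideanSpace ℝ (Fin n)) - (σ (h i v₀) : EuclideanSpace ℝ (Fin n))) = 0 := by
    intro σ
    refine sum_smul_sub_eq_zero_of_dist_eq (fun i => ?_) (fun i j => ?_) hrel
    · rw [← hh i]; exact σ.dist_eq v₀ (h i v₀)
    · rw [← hh i, ← hh j]; exact σ.dist_eq (h i v₀) (h j v₀)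
  ext k
  have hk := eq_of_sum_aeval_mul_sub_eq_zero h' hgen p q hq hu
    (fun σ => ((σ : T ≃ᵢ T) v₀ : EuclideanSpace ℝ (Fin n)) k)
    (fun σ => by simpa [h'] using congrArg (fun w => w k) (horbit σ)) (h' i)
  rw [← hh i]
  exact hk

/-- The rational parametrization of the unit circle. -/
noncomputable def circlePoint (s : ℝ) : EuclideanSpace ℝ (Fin 2) :=
  !₂[(1 - s ^ 2) / (1 + s ^ 2), 2 * s / (1 + s ^ 2)]

theorem dist_circlePoint_zero (s : ℝ) : dist (circlePoint s) 0 = 1 := by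
  have hs : 1 + s ^ 2 ≠ 0 := by positivity
  rw [dist_zero_right, EuclideanSpace.norm_eq, Real.sqrt_eq_one]
  simp only [circlePoint, Fin.sum_univ_two, Real.norm_eq_abs, sq_abs]
  simp
  field_simp
  ring

theorem circlePoint_injective : Function.Injective circlePoint := by
  intro s r h
  have hs : 1 + s ^ 2 ≠ 0 := by positivity
  have hr : 1 + r ^ 2 ≠ 0 := by positivity
  have h0 : (1 - s ^ 2) / (1 + s ^ 2) = (1 - r ^ 2) / (1 + r ^ 2) := by
    simpa [circlePoint] using congrArg (fun w => w 0) h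
  have h1 : 2 * s / (1 + s ^ 2) = 2 * r / (1 + r ^ 2) := by
    simpa [circlePoint] using congrArg (fun w => w 1) h
  have hsq : s ^ 2 = r ^ 2 := by
    rw [div_eq_div_iff hs hr] at h0
    linarith
  rw [hsq, div_left_inj' hr] at h1
  linarith

/-- The third finite difference of the quadratic map `j ↦ (1 + (j t) ^ 2) • circlePoint (j t)`
vanishes. -/
theorem circlePoint_relation (t : ℝ) :
    (circlePoint t - circlePoint 0) +
      (3 * (1 + 4 * t ^ 2)) • (circlePoint t - circlePoint (2 * t)) +
      (-(1 + 9 * t ^ 2)) • (circlePoint t - circlePoint (3 * t)) = 0 := by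
  have h1 : 1 + t ^ 2 ≠ 0 := by positivity
  have h2 : 1 + (2 * t) ^ 2 ≠ 0 := by positivity
  have h3 : 1 + (3 * t) ^ 2 ≠ 0 := by positivity
  have e2 : 1 + 4 * t ^ 2 = 1 + (2 * t) ^ 2 := by ring
  have e3 : 1 + 9 * t ^ 2 = 1 + (3 * t) ^ 2 := by ring
  rw [e2, e3]
  ext k
  fin_cases k <;> simp [circlePoint] <;> field_simp <;> ring

/-- For every `k ≥ 16` there is a cyclic `k`-gon (k distinct points on a circle in the
plane) that is not subtransitive; in particular there is a spherical set that is not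
subtransitive. -/
theorem exists_cyclic_kgon_not_subtransitive (k : ℕ) (hk : 16 ≤ k) :
    ∃ x : Fin k → EuclideanSpace ℝ (Fin 2),
      Function.Injective x ∧
      (∃ (c : EuclideanSpace ℝ (Fin 2)) (ρ : ℝ), 0 < ρ ∧ ∀ i, dist (x i) c = ρ) ∧
      ¬ IsSubtransitive (Set.range x) := by
  obtain ⟨t, ht⟩ : ∃ t : ℝ, Transcendental ℚ t :=
    ⟨liouvilleNumber 2, fun h => transcendental_liouvilleNumber le_rfl
      ((IsFractionRing.isAlgebraic_iff ℤ ℚ ℝ).2 h)⟩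
  have ht0 : t ≠ 0 := by
    rintro rfl
    exact ht isAlgebraic_zero
  have hu : Transcendental ℚ (t ^ 2) := ht.pow two_pos
  have hinj : Function.Injective fun i : Fin k => circlePoint (i * t) := by
    intro i j hij
    exact Fin.ext (by exact_mod_cast mul_right_cancel₀ ht0 (circlePoint_injective hij))
  refine ⟨_, hinj, ⟨0, 1, one_pos, fun i => dist_circlePoint_zero _⟩, ?_⟩
  rintro ⟨n, f, T, hfin, hT, hf, hfT⟩
  have hmem : ∀ m : ℕ, m < 16 →
      circlePoint (m * t) ∈ Set.range fun i : Fin k => circlePoint (i * t) :=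
    fun m hm => ⟨⟨m, hm.trans_le hk⟩, rfl⟩
  let a : Fin 3 → ℕ := ![0, 2, 3]
  have ha : ∀ i, a i < 16 := by decide
  let p : Fin 3 → Polynomial ℚ := ![1, 3 * (1 + 4 * Polynomial.X), -(1 + 9 * Polynomial.X)]
  have hp : ∀ i, 0 < (p i).eval (-1 / 5) := by
    intro i
    fin_cases i <;> norm_num [p]
  have hrel : ∑ i, Polynomial.aeval (t ^ 2) (p i) •
      (circlePoint ((1 : ℕ) * t) - circlePoint (a i * t)) = 0 := by
    simpa [Fin.sum_univ_three, p, a, map_ofNat] using circlePoint_relation t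
  have hrel' : ∑ i, Polynomial.aeval (t ^ 2) (p i) •
      (f (circlePoint ((1 : ℕ) * t)) - f (circlePoint (a i * t))) = 0 :=
    sum_smul_sub_eq_zero_of_dist_eq
      (fun i => hf _ (hmem 1 (by norm_num)) _ (hmem _ (ha i)))
      (fun i j => hf _ (hmem _ (ha i)) _ (hmem _ (ha j))) hrel
  have heq := hT.eq_of_sum_aeval_smul_sub_eq_zero hfin
    (hfT (Set.mem_image_of_mem f (hmem 1 (by norm_num))))
    (fun i => hfT (Set.mem_image_of_mem f (hmem _ (ha i)))) p (-1 / 5) hp hu hrel' 0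
  have hdist := hf _ (hmem _ (ha 0)) _ (hmem 1 (by norm_num))
  rw [heq, dist_self, eq_comm, dist_eq_zero] at hdist
  have := circlePoint_injective hdist
  simp [a] at this
  exact ht0 this.symm
end

section
/- Every finite nonempty transitive set is spherical: if X ⊆ EuclideanSpace ℝ (Fin n) is a finite nonempty transitive set, then there exist a point c ∈ EuclideanSpace ℝ (Fin n) and a real number ρ ≥ 0 such that ‖x − c‖ = ρ for every x ∈ X. -/
/-- An affine automorphism preserving a finite nonempty set fixes its centroid. -/
lemma AffineEquiv.map_centroid_of_image_eq {V : Type*} [AddCommGroup V] [Module ℝ V]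
    [DecidableEq V] (f : V ≃ᵃ[ℝ] V) {s : Finset V} (hs : s.Nonempty) (hf : s.image f = s) :
    f (s.centroid ℝ id) = s.centroid ℝ id := by
  calc f (s.centroid ℝ id) = s.centroid ℝ (f ∘ id) :=
        s.map_affineCombination id _
          (s.sum_centroidWeights_eq_one_of_nonempty ℝ hs) f.toAffineMap
    _ = (s.map f.toEquiv.toEmbedding).centroid ℝ id := by
        rw [Finset.centroid_map]; rfl
    _ = s.centroid ℝ id := by
        rw [Finset.map_eq_image]
        exact congrArg (fun t : Finset V ↦ t.centroid ℝ id) hf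

/-- Every finite nonempty transitive set is spherical: all of its points are equidistant
from some centre. -/
theorem transitive_is_spherical {n : ℕ} (X : Set (EuclideanSpace ℝ (Fin n)))
    (hfin : X.Finite) (hne : X.Nonempty) (htrans : IsTransitiveSet X) :
    ∃ (c : EuclideanSpace ℝ (Fin n)) (ρ : ℝ), 0 ≤ ρ ∧ ∀ x ∈ X, dist x c = ρ := by
  classical
  lift X to Finset (EuclideanSpace ℝ (Fin n)) using hfin
  obtain ⟨x₀, hx₀⟩ := hne
  refine ⟨X.centroid ℝ id, dist x₀ (X.centroid ℝ id), dist_nonneg, fun x hx ↦ ?_⟩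
  obtain ⟨g, hgX, hgx⟩ := htrans x hx x₀ hx₀
  have hgc : g (X.centroid ℝ id) = X.centroid ℝ id :=
    g.toRealAffineIsometryEquiv.toAffineEquiv.map_centroid_of_image_eq ⟨x₀, hx₀⟩
      (Finset.coe_injective (by simpa using hgX))
  rw [← hgx]
  nth_rw 2 [← hgc]
  rw [g.dist_eq]
end
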